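/- arXiv:2207.00394 — 7 statements merged into one kernel-verified Lean document; each statement's English description precedes it below -/
import Mathlib

section
/- Let an n-job coupled-task instance be given with the jobs indexed so that a_1 ≤ a_2 ≤ … ≤ a_n. Then for every feasible schedule σ the following holds: if j' is the job whose first task is the j-th one to start in σ (i.e., exactly j−1 first tasks start before S_{j'}), then C_{j'}(σ) ≥ ∑_{i=1}^{j} a_i + L_{j'} + b_{j'}; consequently the total completion time of σ satisfies ∑_{j=1}^{n} C_j(σ) ≥ ∑_{j=1}^{n} ∑_{i=1}^{j} a_i + ∑_{j=1}^{n} L_j + ∑_{j=1}^{n} b_j. -/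
open Finset

/-- The interval occupied by the first task of job `j`. -/
def task1 (a S : ℕ → ℝ) (j : ℕ) : Set ℝ := Set.Ico (S j) (S j + a j)

/-- The interval occupied by the second task of job `j`. -/
def task2 (a L b S : ℕ → ℝ) (j : ℕ) : Set ℝ :=
  Set.Ico (S j + a j + L j) (S j + a j + L j + b j)

/-- A schedule `S` for the `n`-job coupled-task instance `(a, L, b)` is feasible if all start
times are nonnegative and the `2n` task intervals are pairwise disjoint. -/
def Feasible (n : ℕ) (a L b S : ℕ → ℝ) : Prop :=
  (∀ j, j < n → 0 ≤ S j) ∧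
  (∀ i, i < n → ∀ j, j < n → i ≠ j → Disjoint (task1 a S i) (task1 a S j)) ∧
  (∀ i, i < n → ∀ j, j < n → i ≠ j → Disjoint (task2 a L b S i) (task2 a L b S j)) ∧
  (∀ i, i < n → ∀ j, j < n → Disjoint (task1 a S i) (task2 a L b S j))

/-- The completion time of job `j` in schedule `S`. -/
def cTime (a L b S : ℕ → ℝ) (j : ℕ) : ℝ := S j + a j + L j + b j

/-- The total completion time of schedule `S`. -/
def totalC (n : ℕ) (a L b S : ℕ → ℝ) : ℝ := ∑ j ∈ Finset.range n, cTime a L b S j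

lemma aux_sep {n : ℕ} {a L b S : ℕ → ℝ} (ha : ∀ j, j < n → 0 < a j)
    (hf : Feasible n a L b S) {i j : ℕ} (hi : i < n) (hj : j < n) (hij : i ≠ j)
    (h : S i ≤ S j) : S i + a i ≤ S j := by
  by_contra hc
  push Not at hc
  have hd := hf.2.1 i hi j hj hij
  refine Set.disjoint_left.mp hd (show S j ∈ task1 a S i from ⟨h, hc⟩) ⟨le_refl _, ?_⟩
  have := ha j hj
  linarith

lemma aux_sum_le {n : ℕ} {a L b S : ℕ → ℝ} (ha : ∀ j, j < n → 0 < a j)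
    (hf : Feasible n a L b S) (T : Finset ℕ) :
    (∀ i ∈ T, i < n) → ∀ M : ℝ, 0 ≤ M → (∀ i ∈ T, S i + a i ≤ M) → ∑ i ∈ T, a i ≤ M := by
  induction T using Finset.induction_on_max_value S with
  | empty => intro _ M hM _; simpa using hM
  | insert x s hx hmax ih =>
    intro hT M hM hle
    rw [Finset.sum_insert hx]
    have hxn : x < n := hT x (Finset.mem_insert_self x s)
    have h1 := ih (fun i hi => hT i (Finset.mem_insert_of_mem hi)) (S x) (hf.1 x hxn)
      (fun i hi => aux_sep ha hf (hT i (Finset.mem_insert_of_mem hi)) hxn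
        (fun h => hx (h ▸ hi)) (hmax i hi))
    have h2 := hle x (Finset.mem_insert_self x s)
    linarith

lemma aux_sorted {n : ℕ} {a : ℕ → ℝ} (hsorted : ∀ i j, i ≤ j → j < n → a i ≤ a j)
    (T : Finset ℕ) : (∀ i ∈ T, i < n) → ∑ i ∈ Finset.range T.card, a i ≤ ∑ i ∈ T, a i := by
  induction T using Finset.induction_on_max with
  | empty => simp
  | insert x s hmax ih =>
    intro hT
    have hx : x ∉ s := fun h => lt_irrefl _ (hmax x h)
    rw [Finset.sum_insert hx, Finset.card_insert_of_notMem hx, Finset.sum_range_succ]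
    have h1 := ih (fun i hi => hT i (Finset.mem_insert_of_mem hi))
    have hc : s.card ≤ x := by
      have : s ⊆ Finset.range x := fun i hi => Finset.mem_range.mpr (hmax i hi)
      simpa using Finset.card_le_card this
    have h2 := hsorted _ x hc (hT x (Finset.mem_insert_self x s))
    linarith

/-- If the jobs are indexed in nondecreasing `a` order, then in any feasible schedule, for the
job `j'` whose first task is the `(k+1)`-th one to start (i.e. exactly `k` first tasks start
before `S j'`), we have `C j' ≥ ∑_{i=0}^{k} a i + L j' + b j'`; consequently the total
completion time is at least `∑_j ∑_{i ≤ j} a i + ∑_j L j + ∑_j b j`. -/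
theorem jth_starting_completion_lower_bound (n : ℕ) (a L b S : ℕ → ℝ)
    (ha : ∀ j, j < n → 0 < a j) (hL : ∀ j, j < n → 0 ≤ L j) (hb : ∀ j, j < n → 0 < b j)
    (hsorted : ∀ i j, i ≤ j → j < n → a i ≤ a j)
    (hfeas : Feasible n a L b S) :
    (∀ j', j' < n →
      (∑ i ∈ Finset.range (((Finset.range n).filter fun i => S i < S j').card + 1), a i)
        + L j' + b j' ≤ cTime a L b S j') ∧
    (∑ j ∈ Finset.range n, ∑ i ∈ Finset.range (j + 1), a i)
        + (∑ j ∈ Finset.range n, L j) + (∑ j ∈ Finset.range n, b j)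
      ≤ ∑ j ∈ Finset.range n, cTime a L b S j := by
  have part1 : ∀ j', j' < n →
      (∑ i ∈ Finset.range (((Finset.range n).filter fun i => S i < S j').card + 1), a i)
        + L j' + b j' ≤ cTime a L b S j' := by
    intro j hj
    have hnot : j ∉ (Finset.range n).filter fun i => S i < S j := by simp
    have hT : ∀ i ∈ insert j ((Finset.range n).filter fun i => S i < S j), i < n := by
      intro i hi
      rcases Finset.mem_insert.mp hi with rfl | hi
      · exact hj
      · exact Finset.mem_range.mp (Finset.mem_filter.mp hi).1
    have h1 := aux_sorted hsorted _ hT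
    rw [Finset.card_insert_of_notMem hnot] at h1
    have haj := ha j hj
    have hSj := hfeas.1 j hj
    have h2 := aux_sum_le ha hfeas _ hT (S j + a j) (by linarith) (by
      intro i hi
      rcases Finset.mem_insert.mp hi with rfl | hi'
      · exact le_refl _
      · have hlt := (Finset.mem_filter.mp hi').2
        have := aux_sep ha hfeas (hT i hi) hj (by rintro rfl; exact lt_irrefl _ hlt) hlt.le
        linarith)
    unfold cTime
    linarith
  refine ⟨part1, ?_⟩
  set r : ℕ → ℕ := fun j => ((Finset.range n).filter fun i => S i < S j).card with hr
  have hlt : ∀ i j, i < n → j < n → S i < S j → r i < r j := by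
    intro i j hi hj h
    apply Finset.card_lt_card
    refine Finset.ssubset_iff_subset_ne.mpr ⟨?_, ?_⟩
    · intro k hk
      simp only [Finset.mem_filter] at hk ⊢
      exact ⟨hk.1, hk.2.trans h⟩
    · intro he
      have : i ∈ (Finset.range n).filter fun k => S k < S i := by
        rw [he]; simp [hi, h]
      simp at this
  have hinj : Set.InjOn r (Finset.range n : Finset ℕ) := by
    intro i hi j hj hij
    have hi' : i < n := by simpa using hi
    have hj' : j < n := by simpa using hj
    by_contra hne
    rcases lt_trichotomy (S i) (S j) with h | h | h
    · have := hlt i j hi' hj' h; omega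
    · have h1 := aux_sep ha hfeas hi' hj' hne h.le
      have := ha i hi'
      linarith
    · have := hlt j i hj' hi' h; omega
  have himg : (Finset.range n).image r = Finset.range n := by
    apply Finset.eq_of_subset_of_card_le
    · intro k hk
      obtain ⟨j, hj, rfl⟩ := Finset.mem_image.mp hk
      rw [Finset.mem_range]
      have hss : ((Finset.range n).filter fun i => S i < S j) ⊂ Finset.range n :=
        Finset.filter_ssubset.mpr ⟨j, hj, lt_irrefl _⟩
      simpa using Finset.card_lt_card hss
    · rw [Finset.card_image_of_injOn hinj]
  have hsum : ∑ j ∈ Finset.range n, ∑ i ∈ Finset.range (j + 1), a i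
      = ∑ j ∈ Finset.range n, ∑ i ∈ Finset.range (r j + 1), a i := by
    conv_lhs => rw [← himg]
    rw [Finset.sum_image hinj]
  rw [hsum, ← Finset.sum_add_distrib, ← Finset.sum_add_distrib]
  exact Finset.sum_le_sum fun j hj => part1 j (Finset.mem_range.mp hj)
end

section
/- Let q be an even positive integer, let e_1, …, e_{3q} be positive integers with ∑_{i=1}^{3q} e_i = qE for a positive integer E and E/4 < e_i < E/2 for all i, and let R be an integer with R > 3qE. Define a coupled-task instance with 4q jobs, common delay time L = R + E for all jobs, and equal first- and second-task processing times: jobs i = 1, …, 3q have a_i = b_i = e_i, and jobs i = 3q+1, …, 4q have a_i = b_i = R. Then this instance admits a feasible schedule with makespan at most q(3E + 2R) if and only if the set {1, …, 3q} can be partitioned into q disjoint triples Q_1, …, Q_q with ∑_{i ∈ Q_x} e_i = E for each x = 1, …, q. -/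
open Finset

lemma tp_sep_of_disjoint {x a y b : ℝ} (ha : 0 < a) (hb : 0 < b)
    (h : Disjoint (Set.Ico x (x + a)) (Set.Ico y (y + b))) : x + a ≤ y ∨ y + b ≤ x := by
  by_contra hc
  push Not at hc
  rw [Set.disjoint_left] at h
  rcases le_total x y with hxy | hxy
  · exact h (a := y) ⟨hxy, hc.1⟩ ⟨le_refl _, by linarith⟩
  · exact h (a := x) ⟨le_refl _, by linarith⟩ ⟨hxy, hc.2⟩

lemma tp_disjoint_of_sep {x a y b : ℝ}
    (h : x + a ≤ y ∨ y + b ≤ x) : Disjoint (Set.Ico x (x + a)) (Set.Ico y (y + b)) := by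
  rw [Set.disjoint_left]
  rintro z ⟨h1, h2⟩ ⟨h3, h4⟩
  rcases h with h | h <;> linarith

/-- Disjoint intervals packed in an interval. -/
lemma tp_packing {ι : Type*} (s : Finset ι) (t a : ι → ℝ) (lo len : ℝ) (hlen : 0 ≤ len)
    (ha : ∀ i ∈ s, 0 < a i) (hlo : ∀ i ∈ s, lo ≤ t i) (hhi : ∀ i ∈ s, t i + a i ≤ lo + len)
    (hsep : ∀ i ∈ s, ∀ j ∈ s, i ≠ j → t i + a i ≤ t j ∨ t j + a j ≤ t i) :
    ∑ i ∈ s, a i ≤ len := by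
  have hd : Set.PairwiseDisjoint (↑s : Set ι) (fun i => Set.Ico (t i) (t i + a i)) := by
    intro i hi j hj hij
    exact tp_disjoint_of_sep (hsep i hi j hj hij)
  have hv := MeasureTheory.measure_biUnion_finset (μ := MeasureTheory.volume) hd
    (fun i _ => measurableSet_Ico)
  have hsub : (⋃ i ∈ s, Set.Ico (t i) (t i + a i)) ⊆ Set.Ico lo (lo + len) := by
    intro z hz
    simp only [Set.mem_iUnion] at hz
    obtain ⟨i, hi, h1, h2⟩ := hz
    exact ⟨(hlo i hi).trans h1, h2.trans_le (hhi i hi)⟩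
  have hm := MeasureTheory.measure_mono (μ := MeasureTheory.volume) hsub
  rw [hv] at hm
  simp only [Real.volume_Ico, add_sub_cancel_left] at hm
  rw [← ENNReal.ofReal_sum_of_nonneg (fun i hi => (ha i hi).le)] at hm
  exact (ENNReal.ofReal_le_ofReal_iff hlen).1 hm

/-- Start of task `s` of job `j`. -/
def tpT (a S : ℕ → ℝ) (L : ℝ) (s : Bool) (j : ℕ) : ℝ := if s then S j + a j + L else S j

lemma tp_feas_sep {n : ℕ} {a S : ℕ → ℝ} {L : ℝ} (ha : ∀ i, i < n → 0 < a i)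
    (h : Feasible n a (fun _ => L) a S) (s s' : Bool) (i j : ℕ) (hi : i < n) (hj : j < n)
    (hne : i ≠ j ∨ s ≠ s') :
    tpT a S L s i + a i ≤ tpT a S L s' j ∨ tpT a S L s' j + a j ≤ tpT a S L s i := by
  obtain ⟨-, h1, h2, h3⟩ := h
  cases s <;> cases s' <;> simp only [tpT] <;> simp at hne ⊢
  · exact tp_sep_of_disjoint (ha i hi) (ha j hj) (h1 i hi j hj hne)
  · exact tp_sep_of_disjoint (ha i hi) (ha j hj) (h3 i hi j hj)
  · exact (tp_sep_of_disjoint (ha j hj) (ha i hi) (h3 j hj i hi)).symm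
  · exact tp_sep_of_disjoint (ha i hi) (ha j hj) (h2 i hi j hj hne)

/-- The delay of every job contains a large task. -/
lemma tp_delay (q : ℕ) (a S : ℕ → ℝ) (E R : ℝ) (hE : 0 < E) (hR : 3 * q * E < R)
    (ha : ∀ i, i < 4 * q → 0 < a i) (hbig : ∀ i, 3 * q ≤ i → a i = R)
    (h : Feasible (4 * q) a (fun _ => R + E) a S)
    (hC : ∀ j, j < 4 * q → S j + a j + (R + E) + a j ≤ q * (3 * E + 2 * R))
    (i : ℕ) (hi : i < 4 * q) :
    ∃ j, 3 * q ≤ j ∧ j < 4 * q ∧ ∃ s, S i + a i ≤ tpT a S (R + E) s j ∧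
      tpT a S (R + E) s j ≤ S i + a i + E := by
  have hsep := tp_feas_sep ha h
  have hq0 : (0 : ℝ) ≤ q := Nat.cast_nonneg q
  have hRpos : 0 < R := lt_of_le_of_lt (by positivity) hR
  have hS := h.1
  by_contra hcon
  push Not at hcon
  have key : ∀ j, 3 * q ≤ j → j < 4 * q → ∀ s,
      tpT a S (R + E) s j + R ≤ S i + a i ∨ S i + a i + (R + E) ≤ tpT a S (R + E) s j := by
    intro j hj1 hj2 s
    have hc := hcon j hj1 hj2 s
    by_contra hh
    push Not at hh
    have haj := hbig j hj1
    have hai := ha i hi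
    by_cases hij : i = j
    · subst hij
      cases s <;> simp only [tpT] at hh <;> simp at hh <;> linarith
    · have h1 := hsep false s i j hi hj2 (Or.inl hij)
      have h2 := hsep true s i j hi hj2 (Or.inl hij)
      have e1 : tpT a S (R + E) false i = S i := by simp [tpT]
      have e2 : tpT a S (R + E) true i = S i + a i + (R + E) := by simp [tpT]
      rw [e1] at h1
      rw [e2] at h2
      rw [haj] at h1 h2
      rcases h1 with h1 | h1
      · have := hc h1
        rcases h2 with h2 | h2 <;> linarith
      · linarith
  let s0 : Finset (Bool × ℕ) := Finset.univ ×ˢ Finset.Ico (3 * q) (4 * q)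
  have hmem : ∀ p ∈ s0, 3 * q ≤ p.2 ∧ p.2 < 4 * q := by
    intro p hp
    simpa [s0] using hp
  have hpack := tp_packing (Finset.insertNone s0)
    (fun o => o.elim (S i + a i) (fun p => tpT a S (R + E) p.1 p.2))
    (fun o => o.elim (R + E) (fun _ => R)) 0 (q * (3 * E + 2 * R)) (by positivity)
    (by
      rintro (_ | p) _
      · simp; linarith
      · simpa using hRpos)
    (by
      rintro (_ | p) hp
      · have := hS i hi
        have := ha i hi
        simp; linarith
      · have hp' := hmem p (by simpa using hp)
        have := hS p.2 hp'.2
        have := ha p.2 hp'.2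
        simp only [Option.elim, tpT]
        split_ifs <;> linarith)
    (by
      rintro (_ | p) hp
      · have := hC i hi
        have := ha i hi
        simp; linarith
      · have hp' := hmem p (by simpa using hp)
        have := hC p.2 hp'.2
        have := hbig p.2 hp'.1
        simp only [Option.elim, tpT]
        split_ifs <;> linarith)
    (by
      rintro (_ | p) hp (_ | r) hr hne
      · exact absurd rfl hne
      · have hr' := hmem r (by simpa using hr)
        have := key r.2 hr'.1 hr'.2 r.1
        simp only [Option.elim]
        tauto
      · have hr' := hmem p (by simpa using hp)
        have := key p.2 hr'.1 hr'.2 p.1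
        simp only [Option.elim]
        tauto
      · have hp' := hmem p (by simpa using hp)
        have hr' := hmem r (by simpa using hr)
        have h5 := hsep p.1 r.1 p.2 r.2 hp'.2 hr'.2 (by
          by_contra h6
          push Not at h6
          apply hne
          rw [Prod.ext h6.2 h6.1])
        rw [hbig _ hp'.1, hbig _ hr'.1] at h5
        simpa using h5)
  rw [Finset.sum_insertNone] at hpack
  have hcard : s0.card = 2 * q := by
    simp [s0]; omega
  simp [hcard] at hpack
  linarith

lemma tp_assign (q : ℕ) (hq : 0 < q) (a S : ℕ → ℝ) (E R : ℝ) (hE : 0 < E) (hR : 3 * q * E < R)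
    (ha : ∀ i, i < 4 * q → 0 < a i) (hbig : ∀ i, 3 * q ≤ i → a i = R)
    (h : Feasible (4 * q) a (fun _ => R + E) a S)
    (hC : ∀ j, j < 4 * q → S j + a j + (R + E) + a j ≤ q * (3 * E + 2 * R)) :
    ∃ lo : ℕ → ℝ, ∀ i, i < 3 * q → ∃ j, (3 * q ≤ j ∧ j < 4 * q) ∧ ∃ s,
      lo j ≤ tpT a S (R + E) s i ∧ tpT a S (R + E) s i + a i ≤ lo j + E := by
  have hsep := tp_feas_sep ha h
  have hdel := tp_delay q a S E R hE hR ha hbig h hC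
  have hq1 : (1 : ℝ) ≤ q := by exact_mod_cast hq
  have hER : E < R := by nlinarith
  have hpart : ∀ j, 3 * q ≤ j → j < 4 * q → ∃ k, 3 * q ≤ k ∧ k < 4 * q ∧
      ((S j + R ≤ S k ∧ S k ≤ S j + R + E) ∨ (S k + R ≤ S j ∧ S j ≤ S k + R + E)) := by
    intro j h1 h2
    obtain ⟨k, hk1, hk2, s, hs1, hs2⟩ := hdel j h2
    refine ⟨k, hk1, hk2, ?_⟩
    rw [hbig j h1] at hs1 hs2
    cases s <;> simp only [tpT, hbig k hk1] at hs1 hs2 <;> simp at hs1 hs2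
    · left; constructor <;> linarith
    · right; constructor <;> linarith
  have huniq : ∀ j k l, 3 * q ≤ j → j < 4 * q → 3 * q ≤ k → k < 4 * q → 3 * q ≤ l → l < 4 * q →
      ((S j + R ≤ S k ∧ S k ≤ S j + R + E) ∨ (S k + R ≤ S j ∧ S j ≤ S k + R + E)) →
      ((S j + R ≤ S l ∧ S l ≤ S j + R + E) ∨ (S l + R ≤ S j ∧ S j ≤ S l + R + E)) →
      k = l := by
    intro j k l j1 j2 k1 k2 l1 l2 hk hl
    by_contra hne
    have s1 := hsep false false k l k2 l2 (Or.inl hne)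
    have s2 := hsep false true k l k2 l2 (Or.inl hne)
    have s3 := hsep true false k l k2 l2 (Or.inl hne)
    simp only [tpT, hbig k k1, hbig l l1] at s1 s2 s3
    simp at s1 s2 s3
    rcases hk with hk | hk <;> rcases hl with hl | hl
    · rcases s1 with s1 | s1 <;> linarith
    · rcases s2 with s2 | s2 <;> linarith
    · rcases s3 with s3 | s3 <;> linarith
    · rcases s1 with s1 | s1 <;> linarith
  choose! p hp1 hp2 hp3 using hpart
  have hinv : ∀ j, 3 * q ≤ j → j < 4 * q → p (p j) = j := by
    intro j h1 h2
    have g1 := hp1 j h1 h2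
    have g2 := hp2 j h1 h2
    exact huniq (p j) (p (p j)) j g1 g2 (hp1 _ g1 g2) (hp2 _ g1 g2) h1 h2 (hp3 _ g1 g2)
      (hp3 j h1 h2).symm
  refine ⟨fun j => if S j < S (p j) then S j + R else S (p j) + 3 * R + E, ?_⟩
  intro i hi
  have hi4 : i < 4 * q := by omega
  obtain ⟨j, j1, j2, s, hs1, hs2⟩ := hdel i hi4
  have k1 := hp1 j j1 j2
  have k2 := hp2 j j1 j2
  have hpp := hinv j j1 j2
  have hj := hp3 j j1 j2
  have hai := ha i hi4
  have sj : ∀ s s', _ := fun s s' => hsep s s' i j hi4 j2 (Or.inl (by omega))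
  have sk : ∀ s s', _ := fun s s' => hsep s s' i (p j) hi4 k2 (Or.inl (by omega))
  rw [hbig _ j1] at sj
  rw [hbig _ k1] at sk
  rcases hj with hj | hj
  · have c1 : S j < S (p j) := by linarith
    have c2 : ¬ S (p j) < S j := by linarith
    cases s
    · refine ⟨j, ⟨j1, j2⟩, true, ?_⟩
      have := sk true false
      simp only [tpT, c1, if_true] at hs1 hs2 this ⊢
      simp at hs1 hs2 this ⊢
      constructor
      · linarith
      · rcases this with g | g <;> linarith
    · refine ⟨p j, ⟨k1, k2⟩, true, ?_⟩
      have := sk true true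
      simp only [tpT, hpp, c2, if_false, hbig _ j1, hbig _ k1] at hs1 hs2 this ⊢
      simp at hs1 hs2 this ⊢
      constructor
      · linarith
      · rcases this with g | g <;> linarith
  · have c1 : ¬ S j < S (p j) := by linarith
    have c2 : S (p j) < S j := by linarith
    cases s
    · refine ⟨p j, ⟨k1, k2⟩, false, ?_⟩
      have := sk false false
      simp only [tpT, hpp, c2, if_true] at hs1 hs2 this ⊢
      simp at hs1 hs2 this ⊢
      constructor
      · rcases this with g | g <;> linarith
      · linarith
    · refine ⟨j, ⟨j1, j2⟩, false, ?_⟩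
      have := sk false true
      simp only [tpT, c1, if_false, hbig _ j1, hbig _ k1] at hs1 hs2 this ⊢
      simp at hs1 hs2 this ⊢
      constructor
      · rcases this with g | g <;> linarith
      · linarith

/-- Shape of a job inside a block starting at `T`. -/
def tpShape (E R T S a pos : ℝ) (x : ℕ) (sm : Prop) : Prop :=
  (¬ sm ∧ x % 2 = 0 ∧ S = T + 2 * E ∧ a = R) ∨
  (¬ sm ∧ x % 2 = 1 ∧ S = T + 3 * E + R ∧ a = R) ∨
  (sm ∧ x % 2 = 0 ∧ S = T + 2 * E - pos - 2 * a ∧ 0 ≤ pos ∧ pos + a ≤ E ∧ 0 < a ∧ 2 * a < E) ∨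
  (sm ∧ x % 2 = 1 ∧ S = T + 3 * R + 3 * E + pos ∧ 0 ≤ pos ∧ pos + a ≤ E ∧ 0 < a ∧ 2 * a < E)

lemma tp_shape_range {E R T S a pos : ℝ} {x : ℕ} {sm : Prop} (hE : 0 < E) (hR : 0 < R)
    (h : tpShape E R T S a pos x sm) :
    T ≤ S ∧ S + a + (R + E) + a ≤ T + (4 * R + 6 * E) ∧ 0 < a := by
  rcases h with ⟨-, -, h, h'⟩ | ⟨-, -, h, h'⟩ | ⟨-, -, h, h1, h2, h3, h4⟩ |
    ⟨-, -, h, h1, h2, h3, h4⟩ <;> subst h <;> try subst h'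
  all_goals refine ⟨by linarith, by linarith, by linarith⟩

lemma tp_shape_sep {E R T S a pos S' a' pos' : ℝ} {x x' : ℕ} {sm sm' : Prop}
    (hE : 0 < E) (hR : 0 < R)
    (h : tpShape E R T S a pos x sm) (h' : tpShape E R T S' a' pos' x' sm')
    (hbb : ¬ sm → ¬ sm' → x % 2 ≠ x' % 2)
    (hss : sm → sm' → x % 2 = x' % 2 →
      (a ≤ a' ∧ pos + a ≤ pos') ∨ (a' ≤ a ∧ pos' + a' ≤ pos)) :
    (S + a ≤ S' ∨ S' + a' ≤ S) ∧
    (S + a + (R + E) + a ≤ S' + a' + (R + E) ∨ S' + a' + (R + E) + a' ≤ S + a + (R + E)) ∧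
    (S + a ≤ S' + a' + (R + E) ∨ S' + a' + (R + E) + a' ≤ S) := by
  rcases h with ⟨m, n, h, h0⟩ | ⟨m, n, h, h0⟩ | ⟨m, n, h, h1, h2, h3, h4⟩ |
    ⟨m, n, h, h1, h2, h3, h4⟩ <;>
  rcases h' with ⟨m', n', g, g0⟩ | ⟨m', n', g, g0⟩ | ⟨m', n', g, g1, g2, g3, g4⟩ |
    ⟨m', n', g, g1, g2, g3, g4⟩ <;>
  first
  | exact absurd (n.trans n'.symm) (hbb m m')
  | (subst h; subst g; try subst h0
     try subst g0
     refine ⟨?_, ?_, ?_⟩ <;> first | (left; linarith) | (right; linarith))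
  | (subst h; subst g
     rcases hss m m' (n.trans n'.symm) with ⟨u, v⟩ | ⟨u, v⟩ <;>
     refine ⟨?_, ?_, ?_⟩ <;> first | (left; linarith) | (right; linarith))

lemma tp_construct (q : ℕ) (hqe : Even q) (a : ℕ → ℝ) (E R : ℝ) (hE : 0 < E) (hR : 0 < R)
    (hbig : ∀ i, 3 * q ≤ i → a i = R)
    (he : ∀ i, i < 3 * q → 0 < a i)
    (hhigh : ∀ i, i < 3 * q → 2 * a i < E)
    (Q : ℕ → Finset ℕ) (hQ1 : ∀ x, x < q → Q x ⊆ Finset.range (3 * q))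
    (hQ3 : ∀ i, i < 3 * q → ∃ x, x < q ∧ i ∈ Q x)
    (hQ4 : ∀ x, x < q → ∑ i ∈ Q x, a i = E) :
    ∃ S : ℕ → ℝ, Feasible (4 * q) a (fun _ => R + E) a S ∧
      ∀ j, j < 4 * q → S j + a j + (R + E) + a j ≤ q * (3 * E + 2 * R) := by
  choose! f hf1 hf2 using hQ3
  let X : ℕ → ℕ := fun i => if i < 3 * q then f i else i - 3 * q
  let lt : ℕ → ℕ → Prop := fun k i => a k < a i ∨ (a k = a i ∧ k < i)
  classical
  let pos : ℕ → ℝ := fun i => ∑ k ∈ (Q (f i)).filter (fun k => lt k i), a k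
  let T : ℕ → ℝ := fun i => ((X i / 2 : ℕ) : ℝ) * (4 * R + 6 * E)
  let S : ℕ → ℝ := fun i =>
    if i < 3 * q then
      (if X i % 2 = 0 then T i + 2 * E - pos i - 2 * a i else T i + 3 * R + 3 * E + pos i)
    else (if X i % 2 = 0 then T i + 2 * E else T i + 3 * E + R)
  have hXq : ∀ i, i < 4 * q → X i < q := by
    intro i hi
    simp only [X]
    split_ifs with h
    · exact hf1 i h
    · omega
  have hpos0 : ∀ i, i < 3 * q → 0 ≤ pos i := by
    intro i hi
    apply Finset.sum_nonneg
    intro k hk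
    have := hQ1 _ (hf1 i hi) (Finset.mem_filter.1 hk).1
    exact (he k (Finset.mem_range.1 this)).le
  have hposE : ∀ i, i < 3 * q → ∀ k, k < 3 * q → f i = f k → lt i k →
      pos i + a i ≤ pos k := by
    intro i hi k hk hik hlt
    have hni : i ∉ (Q (f i)).filter (fun k => lt k i) := by
      simp [lt]
    have : pos i + a i = ∑ l ∈ insert i ((Q (f i)).filter (fun k => lt k i)), a l := by
      rw [Finset.sum_insert hni]; simp only [pos]; ring
    rw [this]
    apply Finset.sum_le_sum_of_subset_of_nonneg
    · intro l hl
      rw [Finset.mem_insert] at hl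
      rw [Finset.mem_filter]
      rcases hl with rfl | hl
      · exact ⟨hik ▸ hf2 _ hi, hlt⟩
      · rw [Finset.mem_filter] at hl
        refine ⟨hik ▸ hl.1, ?_⟩
        have h1 := hl.2
        simp only [lt] at h1 hlt ⊢
        rcases h1 with h1 | h1 <;> rcases hlt with h2 | h2
        · left; linarith
        · left; linarith
        · left; linarith
        · right; exact ⟨by linarith, by omega⟩
    · intro l hl _
      have := hQ1 _ (hf1 k hk) (Finset.mem_filter.1 hl).1
      exact (he l (Finset.mem_range.1 this)).le
  have hposL : ∀ i, i < 3 * q → pos i + a i ≤ E := by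
    intro i hi
    have hni : i ∉ (Q (f i)).filter (fun k => lt k i) := by
      simp [lt]
    have : pos i + a i = ∑ l ∈ insert i ((Q (f i)).filter (fun k => lt k i)), a l := by
      rw [Finset.sum_insert hni]; simp only [pos]; ring
    rw [this, ← hQ4 _ (hf1 i hi)]
    apply Finset.sum_le_sum_of_subset_of_nonneg
    · intro l hl
      rw [Finset.mem_insert] at hl
      rcases hl with rfl | hl
      · exact hf2 _ hi
      · exact (Finset.mem_filter.1 hl).1
    · intro l hl _
      have := hQ1 _ (hf1 i hi) hl
      exact (he l (Finset.mem_range.1 this)).le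
  have hshape : ∀ i, tpShape E R (T i) (S i) (a i) (pos i) (X i) (i < 3 * q) := by
    intro i
    unfold tpShape
    by_cases hi : i < 3 * q
    · rcases Nat.mod_two_eq_zero_or_one (X i) with hx | hx
      · right; right; left
        exact ⟨hi, hx, by simp [S, hi, hx], hpos0 i hi, hposL i hi, he i hi, hhigh i hi⟩
      · right; right; right
        exact ⟨hi, hx, by simp [S, hi, hx], hpos0 i hi, hposL i hi, he i hi, hhigh i hi⟩
    · rcases Nat.mod_two_eq_zero_or_one (X i) with hx | hx
      · left
        exact ⟨hi, hx, by simp [S, hi, hx], hbig i (by omega)⟩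
      · right; left
        exact ⟨hi, hx, by simp [S, hi, hx], hbig i (by omega)⟩
  have hrange := fun i => tp_shape_range hE hR (hshape i)
  have hB : 0 < 4 * R + 6 * E := by linarith
  have hTlt : ∀ i j, X i / 2 < X j / 2 → T i + (4 * R + 6 * E) ≤ T j := by
    intro i j hij
    have : ((X i / 2 : ℕ) : ℝ) + 1 ≤ ((X j / 2 : ℕ) : ℝ) := by exact_mod_cast hij
    simp only [T]
    nlinarith
  have hsep : ∀ i, i < 4 * q → ∀ j, j < 4 * q → i ≠ j →
      (S i + a i ≤ S j ∨ S j + a j ≤ S i) ∧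
      (S i + a i + (R + E) + a i ≤ S j + a j + (R + E) ∨
        S j + a j + (R + E) + a j ≤ S i + a i + (R + E)) ∧
      (S i + a i ≤ S j + a j + (R + E) ∨ S j + a j + (R + E) + a j ≤ S i) := by
    intro i hi j hj hij
    rcases lt_trichotomy (X i / 2) (X j / 2) with hlt | heq | hlt
    · have := hTlt i j hlt
      obtain ⟨r1, r2, r3⟩ := hrange i
      obtain ⟨t1, t2, t3⟩ := hrange j
      refine ⟨?_, ?_, ?_⟩ <;> left <;> linarith
    · have hT : T i = T j := by simp only [T, heq]
      have h1 := hshape i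
      rw [hT] at h1
      refine tp_shape_sep hE hR h1 (hshape j) ?_ ?_
      · intro b1 b2 hm
        have : X i = X j := by omega
        simp only [X, b1, b2, if_false] at this
        omega
      · intro b1 b2 hm
        have : X i = X j := by omega
        simp only [X, b1, b2, if_true] at this
        rcases lt_trichotomy (a i) (a j) with h | h | h
        · left; exact ⟨h.le, hposE i b1 j b2 this (Or.inl h)⟩
        · rcases lt_or_gt_of_ne hij with h' | h'
          · left; exact ⟨h.le, hposE i b1 j b2 this (Or.inr ⟨h, h'⟩)⟩
          · right; exact ⟨h.ge, hposE j b2 i b1 this.symm (Or.inr ⟨h.symm, h'⟩)⟩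
        · right; exact ⟨h.le, hposE j b2 i b1 this.symm (Or.inl h)⟩
    · have := hTlt j i hlt
      obtain ⟨r1, r2, r3⟩ := hrange i
      obtain ⟨t1, t2, t3⟩ := hrange j
      refine ⟨?_, ?_, ?_⟩ <;> right <;> linarith
  refine ⟨S, ⟨?_, ?_, ?_, ?_⟩, ?_⟩
  · intro j hj
    have : 0 ≤ T j := by simp only [T]; positivity
    linarith [(hrange j).1]
  · intro i hi j hj hij
    exact tp_disjoint_of_sep (hsep i hi j hj hij).1
  · intro i hi j hj hij
    exact tp_disjoint_of_sep (hsep i hi j hj hij).2.1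
  · intro i hi j hj
    apply tp_disjoint_of_sep
    by_cases hij : i = j
    · subst hij
      left; linarith
    · exact (hsep i hi j hj hij).2.2
  · intro j hj
    have h1 := (hrange j).2.1
    have h2 := hXq j hj
    obtain ⟨r, hr⟩ := hqe
    have h3 : X j / 2 + 1 ≤ r := by omega
    have h4 : ((X j / 2 : ℕ) : ℝ) + 1 ≤ (r : ℝ) := by exact_mod_cast h3
    have h5 : (q : ℝ) = r + r := by rw [hr]; push_cast; ring
    simp only [T] at h1
    rw [h5]
    nlinarith

/-- The 3-Partition reduction: for an even `q > 0`, item sizes `e i` (for `i < 3q`) summing to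
`q * E` with `E/4 < e i < E/2`, and `R > 3qE`, the coupled-task instance with `4q` jobs, common
delay `R + E`, `a i = b i = e i` for the `3q` small jobs and `a i = b i = R` for the `q` large
jobs, has a feasible schedule with makespan at most `q(3E + 2R)` iff the items can be
partitioned into `q` disjoint triples each summing to `E`. -/
theorem three_partition_reduction (q : ℕ) (hq : 0 < q) (hqe : Even q)
    (e : ℕ → ℤ) (E R : ℤ) (hE : 0 < E)
    (he : ∀ i, i < 3 * q → 0 < e i)
    (hsum : ∑ i ∈ Finset.range (3 * q), e i = q * E)
    (hlow : ∀ i, i < 3 * q → E < 4 * e i)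
    (hhigh : ∀ i, i < 3 * q → 2 * e i < E)
    (hR : 3 * q * E < R) :
    (∃ S : ℕ → ℝ,
      Feasible (4 * q) (fun i => if i < 3 * q then (e i : ℝ) else (R : ℝ))
        (fun _ => (R : ℝ) + (E : ℝ)) (fun i => if i < 3 * q then (e i : ℝ) else (R : ℝ)) S ∧
      ∀ j, j < 4 * q →
        cTime (fun i => if i < 3 * q then (e i : ℝ) else (R : ℝ))
          (fun _ => (R : ℝ) + (E : ℝ)) (fun i => if i < 3 * q then (e i : ℝ) else (R : ℝ)) S j
          ≤ (q : ℝ) * (3 * (E : ℝ) + 2 * (R : ℝ))) ↔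
    (∃ Q : ℕ → Finset ℕ,
      (∀ x, x < q → Q x ⊆ Finset.range (3 * q)) ∧
      (∀ x, x < q → (Q x).card = 3) ∧
      (∀ x, x < q → ∀ y, y < q → x ≠ y → Disjoint (Q x) (Q y)) ∧
      (∀ i, i < 3 * q → ∃ x, x < q ∧ i ∈ Q x) ∧
      (∀ x, x < q → ∑ i ∈ Q x, e i = E)) := by
  have hER : (0 : ℝ) < E := by exact_mod_cast hE
  have hRR : 3 * (q : ℝ) * E < R := by exact_mod_cast hR
  have hRpos : (0 : ℝ) < R := lt_of_le_of_lt (by positivity) hRR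
  set a : ℕ → ℝ := fun i => if i < 3 * q then (e i : ℝ) else (R : ℝ) with ha_def
  have hbig : ∀ i, 3 * q ≤ i → a i = R := by
    intro i hi
    simp only [a, if_neg (not_lt.2 hi)]
  have hsmall : ∀ i, i < 3 * q → a i = e i := by
    intro i hi
    simp only [a, if_pos hi]
  have hapos : ∀ i, 0 < a i := by
    intro i
    by_cases hi : i < 3 * q
    · rw [hsmall i hi]; exact_mod_cast he i hi
    · rw [hbig i (by omega)]; exact hRpos
  constructor
  · rintro ⟨S, hF, hC⟩
    have hC' : ∀ j, j < 4 * q → S j + a j + ((R : ℝ) + E) + a j ≤ q * (3 * E + 2 * R) := hC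
    obtain ⟨lo, hlo⟩ := tp_assign q hq a S E R hER hRR (fun i _ => hapos i) hbig hF hC'
    choose! φ hφ s hs1 hs2 using hlo
    have hsep := tp_feas_sep (fun i _ => hapos i) hF
    let Q : ℕ → Finset ℕ := fun x => (Finset.range (3 * q)).filter (fun i => φ i = 3 * q + x)
    have hmem : ∀ x i, i ∈ Q x ↔ i < 3 * q ∧ φ i = 3 * q + x := by
      intro x i
      simp [Q]
    have hle : ∀ x ∈ Finset.range q, ∑ i ∈ Q x, e i ≤ E := by
      intro x _
      have h1 := tp_packing (Q x) (fun i => tpT a S (R + E) (s i) i) a (lo (3 * q + x)) E hER.le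
        (fun i _ => hapos i)
        (by
          intro i hi
          rw [hmem] at hi
          rw [← hi.2]
          exact hs1 i hi.1)
        (by
          intro i hi
          rw [hmem] at hi
          rw [← hi.2]
          exact hs2 i hi.1)
        (by
          intro i hi j hj hij
          rw [hmem] at hi hj
          exact hsep (s i) (s j) i j (by omega) (by omega) (Or.inl hij))
      have h2 : ∑ i ∈ Q x, a i = ((∑ i ∈ Q x, e i : ℤ) : ℝ) := by
        push_cast
        exact Finset.sum_congr rfl (fun i hi => hsmall i ((hmem x i).1 hi).1)
      rw [h2] at h1
      exact_mod_cast h1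
    have htot : ∑ x ∈ Finset.range q, ∑ i ∈ Q x, e i = ∑ x ∈ Finset.range q, E := by
      rw [Finset.sum_const, Finset.card_range, nsmul_eq_mul, ← hsum]
      rw [← Finset.sum_fiberwise_of_maps_to (s := Finset.range (3 * q)) (t := Finset.range q)
        (g := fun i => φ i - 3 * q)]
      · apply Finset.sum_congr rfl
        intro x _
        apply Finset.sum_congr _ (fun _ _ => rfl)
        ext i
        rw [hmem, Finset.mem_filter, Finset.mem_range]
        constructor
        · rintro ⟨h1, h2⟩
          exact ⟨h1, by omega⟩
        · rintro ⟨h1, h2⟩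
          have := hφ i h1
          exact ⟨h1, by omega⟩
      · intro i hi
        rw [Finset.mem_range] at hi ⊢
        have := hφ i hi
        omega
    have heq := (Finset.sum_eq_sum_iff_of_le hle).1 htot
    have hQE : ∀ x, x < q → ∑ i ∈ Q x, e i = E := fun x hx => heq x (Finset.mem_range.2 hx)
    refine ⟨Q, ?_, ?_, ?_, ?_, hQE⟩
    · intro x _
      exact Finset.filter_subset _ _
    · intro x hx
      have h0 := hQE x hx
      have hne : (Q x).Nonempty := by
        rw [Finset.nonempty_iff_ne_empty]
        intro h
        rw [h] at h0
        simp at h0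
        omega
      have h1 : ∑ i ∈ Q x, E < ∑ i ∈ Q x, 4 * e i :=
        Finset.sum_lt_sum_of_nonempty hne (fun i hi => hlow i ((hmem x i).1 hi).1)
      have h2 : ∑ i ∈ Q x, 2 * e i < ∑ i ∈ Q x, E :=
        Finset.sum_lt_sum_of_nonempty hne (fun i hi => hhigh i ((hmem x i).1 hi).1)
      rw [← Finset.mul_sum, h0, Finset.sum_const, nsmul_eq_mul] at h1 h2
      have h3 : ((Q x).card : ℤ) < 4 := lt_of_mul_lt_mul_right h1 hE.le
      have h4 : 2 < ((Q x).card : ℤ) := lt_of_mul_lt_mul_right h2 hE.le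
      omega
    · intro x _ y _ hxy
      rw [Finset.disjoint_left]
      intro i hi hj
      rw [hmem] at hi hj
      omega
    · intro i hi
      have := hφ i hi
      exact ⟨φ i - 3 * q, by omega, (hmem _ _).2 ⟨hi, by omega⟩⟩
  · rintro ⟨Q, hQ1, -, -, hQ3, hQ4⟩
    obtain ⟨S, h1, h2⟩ := tp_construct q hqe a E R hER hRpos hbig (fun i _ => hapos i)
      (by
        intro i hi
        rw [hsmall i hi]
        exact_mod_cast hhigh i hi) Q hQ1 hQ3
      (by
        intro x hx
        rw [← hQ4 x hx]
        push_cast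
        exact Finset.sum_congr rfl
          (fun i hi => hsmall i (Finset.mem_range.1 (hQ1 x hx hi))))
    exact ⟨S, h1, h2⟩
end

section
/- Let I be an n-job coupled-task instance with unit tasks (a_j = b_j = 1 for all j), arbitrary integer delay times L_j, and a prescribed processing sequence π for the first tasks, and let C be a positive integer. Let M be an integer with M > nC. Define an instance I' with n + M unit-task jobs: the first n jobs are the jobs of I, and helper jobs j = n+1, …, n+M have L_j = C + 2(j − n − 1); the prescribed first-task sequence of I' schedules the helper jobs first in decreasing index order n+M, n+M−1, …, n+1, followed by the jobs of I in the order π. Let z = n(M + C) + M² + M(M+1)/2 + MC. Then I has a feasible schedule respecting π with makespan at most C if and only if I' has a feasible schedule respecting its prescribed first-task sequence with total completion time at most z. -/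
open Finset

theorem unit_disj (x y : ℝ) :
    Disjoint (Set.Ico x (x + 1)) (Set.Ico y (y + 1)) ↔ (x + 1 ≤ y ∨ y + 1 ≤ x) := by
  rw [Set.Ico_disjoint_Ico, min_le_iff, le_max_iff, le_max_iff]
  constructor
  · rintro ((h | h) | (h | h))
    · linarith
    · exact Or.inl h
    · exact Or.inr h
    · linarith
  · rintro (h | h)
    · exact Or.inl (Or.inr h)
    · exact Or.inr (Or.inl h)

theorem feasible_unit_iff (n : ℕ) (L S : ℕ → ℝ) :
    Feasible n (fun _ => 1) L (fun _ => 1) S ↔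
      (∀ j, j < n → 0 ≤ S j) ∧
      (∀ i, i < n → ∀ j, j < n → i ≠ j → (S i + 1 ≤ S j ∨ S j + 1 ≤ S i)) ∧
      (∀ i, i < n → ∀ j, j < n → i ≠ j →
        (S i + 1 + L i + 1 ≤ S j + 1 + L j ∨ S j + 1 + L j + 1 ≤ S i + 1 + L i)) ∧
      (∀ i, i < n → ∀ j, j < n →
        (S i + 1 ≤ S j + 1 + L j ∨ S j + 1 + L j + 1 ≤ S i)) := by
  simp only [Feasible, task1, task2, unit_disj]

/-- A unit interval starting after `q - 1` and avoiding a block of `m` unit intervals starting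
at `q` starts after the block. -/
theorem block_skip (x q : ℝ) (m : ℕ) (hx : q - 1 < x)
    (h : ∀ i : ℕ, i < m → (x + 1 ≤ q + i ∨ q + i + 1 ≤ x)) : q + m - 1 < x ∧ (0 < m → q + m ≤ x) := by
  induction m with
  | zero => simpa using hx
  | succ m ih =>
    have h1 := (ih (fun i hi => h i (by omega))).1
    push_cast
    rcases h m (by omega) with h2 | h2
    · linarith
    · exact ⟨by linarith, fun _ => by linarith⟩

theorem sum_helper (M : ℕ) (c : ℝ) :
    ∑ k ∈ Finset.range M, ((M : ℝ) + c + k + 1)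
      = (M : ℝ) ^ 2 + (M : ℝ) * ((M : ℝ) + 1) / 2 + (M : ℝ) * c := by
  have h : ∀ m : ℕ, ∑ k ∈ Finset.range m, ((M : ℝ) + c + k + 1)
      = m * ((M : ℝ) + c) + (m : ℝ) * (m + 1) / 2 := by
    intro m
    induction m with
    | zero => simp
    | succ m ih => rw [Finset.sum_range_succ, ih]; push_cast; ring
  rw [h]; ring

theorem reduction_forward (n : ℕ) (L : ℕ → ℝ)
    (hL : ∀ j, j < n → 0 ≤ L j) (C M : ℕ) (S : ℕ → ℝ)
    (hF : Feasible n (fun _ => 1) L (fun _ => 1) S)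
    (hc : ∀ j, j < n → S j + 1 + L j + 1 ≤ (C : ℝ)) (S' : ℕ → ℝ)
    (h1 : ∀ j, j < n → S' j = S j + M)
    (h2 : ∀ k, S' (n + k) = (M : ℝ) - 1 - k) :
    Feasible (n + M) (fun _ => 1)
          (fun j => if j < n then L j else (C : ℝ) + 2 * ((j - n : ℕ) : ℝ))
          (fun _ => 1) S' := by
  rw [feasible_unit_iff] at hF ⊢
  obtain ⟨f0, f1, f2, f3⟩ := hF
  have key : ∀ j, j < n + M → j < n ∨ ∃ k, k < M ∧ j = n + k := by
    intro j hj
    by_cases h : j < n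
    · exact Or.inl h
    · exact Or.inr ⟨j - n, by omega, by omega⟩
  have cast1 : ∀ k, k < M → (k : ℝ) + 1 ≤ M := fun k hk => by exact_mod_cast hk
  have cast2 : ∀ k l : ℕ, n + k ≠ n + l → (k : ℝ) + 1 ≤ l ∨ (l : ℝ) + 1 ≤ k := by
    intro k l h
    rcases Nat.lt_or_gt_of_ne (fun e => h (by rw [e]) : k ≠ l) with h | h
    · left; exact_mod_cast h
    · right; exact_mod_cast h
  have nn : ∀ k : ℕ, (0 : ℝ) ≤ k := fun k => Nat.cast_nonneg k
  refine ⟨?_, ?_, ?_, ?_⟩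
  · intro j hj
    rcases key j hj with h | ⟨k, hk, rfl⟩
    · rw [h1 j h]; linarith [f0 j h, nn M]
    · rw [h2]; linarith [cast1 k hk]
  · intro i hi j hj hij
    rcases key i hi with h | ⟨k, hk, rfl⟩ <;> rcases key j hj with h' | ⟨l, hl, rfl⟩
    · rw [h1 _ h, h1 _ h']
      rcases f1 i h j h' hij with q | q
      · left; linarith
      · right; linarith
    · rw [h1 _ h, h2]; right; linarith [f0 i h, nn l]
    · rw [h1 _ h', h2]; left; linarith [f0 j h', nn k]
    · rw [h2, h2]
      rcases cast2 k l hij with q | q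
      · right; linarith
      · left; linarith
  · intro i hi j hj hij
    rcases key i hi with h | ⟨k, hk, rfl⟩ <;> rcases key j hj with h' | ⟨l, hl, rfl⟩
    · simp only [h1 _ h, h1 _ h', h, h', if_true]
      rcases f2 i h j h' hij with q | q
      · left; linarith
      · right; linarith
    · simp [h1 _ h, h2, h]; left; linarith [hc i h, nn l]
    · simp [h1 _ h', h2, h']; right; linarith [hc j h', nn k]
    · simp [h2]
      rcases cast2 k l hij with q | q
      · left; linarith
      · right; linarith
  · intro i hi j hj
    rcases key i hi with h | ⟨k, hk, rfl⟩ <;> rcases key j hj with h' | ⟨l, hl, rfl⟩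
    · simp only [h1 _ h, h1 _ h', h', if_true]
      rcases f3 i h j h' with q | q
      · left; linarith
      · right; linarith
    · simp [h1 _ h, h2]; left; linarith [hc i h, nn l, hL i h]
    · simp [h1 _ h', h2, h']; left; linarith [f0 j h', nn k, hL j h']
    · simp [h2]; left; linarith [nn k, nn l, nn C, cast1 l hl]

/-- The analysis of the extended instance: all helpers are delayed by the same amount `e`, and
every original job fits in `[M + e, M + e + C]`. -/
theorem reduction_backward (n : ℕ) (L : ℕ → ℝ)
    (hL : ∀ j, j < n → 0 ≤ L j) (C M : ℕ) (hM : n * C < M) (S h : ℕ → ℝ)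
    (h0 : ∀ k, k < M → 0 ≤ h k)
    (hs : ∀ k, k + 1 < M → h (k + 1) + 1 ≤ h k)
    (hso : ∀ i, i < n → h 0 + 1 ≤ S i)
    (h2 : ∀ k, k < M → ∀ l, l < M → k ≠ l →
      (h k + 2 * k + 1 ≤ h l + 2 * l ∨ h l + 2 * l + 1 ≤ h k + 2 * k))
    (h2o : ∀ i, i < n → ∀ k, k < M →
      (S i + L i + 1 ≤ h k + C + 2 * k ∨ h k + C + 2 * k + 1 ≤ S i + L i))
    (hsum : ∑ j ∈ Finset.range n, (S j + 1 + L j + 1)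
        + ∑ k ∈ Finset.range M, (h k + 1 + ((C : ℝ) + 2 * k) + 1)
      ≤ n * ((M : ℝ) + C) + ∑ k ∈ Finset.range M, ((M : ℝ) + C + k + 1)) :
    ∀ i, i < n → S i + 1 + L i + 1 ≤ h 0 + 1 + C := by
  have hMpos : 0 < M := by omega
  obtain ⟨d, hd⟩ : ∃ d : ℕ → ℝ, ∀ k, d k = h k - ((M : ℝ) - 1 - k) := ⟨_, fun _ => rfl⟩
  have hh : ∀ k, h k = d k + ((M : ℝ) - 1 - k) := fun k => by rw [hd]; ring
  have hMR : (n : ℝ) * C + 1 ≤ M := by exact_mod_cast hM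
  have anti : ∀ l k, k + l < M → d (k + l) ≤ d k := by
    intro l
    induction l with
    | zero => intro k _; simp
    | succ l ih =>
      intro k hk
      have a := ih k (by omega)
      have b := hs (k + l) (by omega)
      rw [hh, hh] at b
      push_cast at b
      have : d (k + (l + 1)) = d (k + l + 1) := rfl
      rw [this]; linarith
  have anti' : ∀ k l, k ≤ l → l < M → d l ≤ d k := by
    intro k l hkl hl
    obtain ⟨m, rfl⟩ := Nat.exists_eq_add_of_le hkl
    exact anti m k hl
  obtain ⟨e, he⟩ : ∃ e, e = d (M - 1) := ⟨_, rfl⟩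
  have he0 : 0 ≤ e := by
    have := h0 (M - 1) (by omega)
    rw [hh, Nat.cast_sub (by omega)] at this
    push_cast at this
    rw [he]; linarith
  have dge : ∀ k, k < M → e ≤ d k := fun k hk => he ▸ anti' k (M - 1) (by omega) (by omega)
  have hS : ∀ i, i < n → (M : ℝ) + e ≤ S i := by
    intro i hi
    have a := hso i hi
    have b := dge 0 hMpos
    rw [hh] at a
    push_cast at a
    linarith
  have hCi : ∀ i ∈ Finset.range n, (M : ℝ) ≤ S i + 1 + L i + 1 := by
    intro i hi
    have hi := Finset.mem_range.1 hi
    linarith [hS i hi, hL i hi]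
  have hsum' : ∑ j ∈ Finset.range n, (S j + 1 + L j + 1) + ∑ k ∈ Finset.range M, d k
      ≤ n * ((M : ℝ) + C) := by
    have : ∑ k ∈ Finset.range M, (h k + 1 + ((C : ℝ) + 2 * k) + 1)
        = ∑ k ∈ Finset.range M, d k + ∑ k ∈ Finset.range M, ((M : ℝ) + C + k + 1) := by
      rw [← Finset.sum_add_distrib]
      refine Finset.sum_congr rfl fun k _ => ?_
      rw [hh]; ring
    rw [this] at hsum
    linarith
  have hD : ∑ k ∈ Finset.range M, d k < M := by
    have := Finset.sum_le_sum hCi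
    simp at this
    nlinarith
  have hD0 : 0 ≤ ∑ k ∈ Finset.range M, d k :=
    Finset.sum_nonneg fun k hk => he0.trans (dge k (Finset.mem_range.1 hk))
  -- all delays agree
  have const : ∀ m k, k + m + 1 = M → d k = e := by
    intro m
    induction m using Nat.strong_induction_on with
    | _ m ih =>
      intro k hk
      rcases Nat.eq_zero_or_pos m with rfl | hm
      · rw [he]; congr 1; omega
      by_contra hne
      have hgt : e < d k := lt_of_le_of_ne (dge k (by omega)) (Ne.symm hne)
      have hskip := (block_skip (d k + k) (k + 1 + e) m (by linarith) (by
        intro i hi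
        have a := ih (m - 1 - i) (by omega) (k + 1 + i) (by omega)
        have b := h2 k (by omega) (k + 1 + i) (by omega) (by omega)
        rw [hh, hh, a] at b
        push_cast at b
        rcases b with b | b
        · left; linarith
        · right; linarith)).2 hm
      have hlow : (k + 1 : ℝ) * (m + 1) ≤ ∑ i ∈ Finset.range (k + 1), d i := by
        have : ∀ i ∈ Finset.range (k + 1), (m + 1 : ℝ) ≤ d i := by
          intro i hi
          have hi := Finset.mem_range.1 hi
          have := anti' i k (by omega) (by omega)
          linarith
        have := Finset.sum_le_sum this
        simp at this
        linarith
      have hle : ∑ i ∈ Finset.range (k + 1), d i ≤ ∑ i ∈ Finset.range M, d i :=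
        Finset.sum_le_sum_of_subset_of_nonneg (Finset.range_subset_range.2 (by omega))
          fun i hi _ => he0.trans (dge i (Finset.mem_range.1 hi))
      have hMk : (M : ℝ) = k + m + 1 := by exact_mod_cast hk.symm
      have : (0 : ℝ) ≤ (k : ℝ) * m := by positivity
      nlinarith
  have dconst : ∀ k, k < M → d k = e := fun k hk => const (M - 1 - k) k (by omega)
  intro i hi
  by_contra hcon
  push Not at hcon
  rw [hh, dconst 0 hMpos] at hcon
  push_cast at hcon
  have hskip := (block_skip (S i + L i) (M - 1 + C + e) M (by linarith) (by
    intro k hk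
    have b := h2o i hi k hk
    rw [hh, dconst k hk] at b
    rcases b with b | b
    · left; linarith
    · right; linarith)).2 hMpos
  have hbig : ∑ j ∈ Finset.range n, ((M : ℝ) + if j = i then (M : ℝ) else 0)
      ≤ ∑ j ∈ Finset.range n, (S j + 1 + L j + 1) := by
    refine Finset.sum_le_sum fun j hj => ?_
    split_ifs with hji
    · subst hji
      have : (0 : ℝ) ≤ C := Nat.cast_nonneg C
      linarith
    · linarith [hCi j hj]
  rw [Finset.sum_add_distrib, Finset.sum_ite_eq' (Finset.range n) i (fun _ => (M : ℝ)),
    if_pos (Finset.mem_range.2 hi)] at hbig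
  simp at hbig
  nlinarith

/-- The reduction for `1|(1, L_j, 1, fixed first-task sequence)|∑ C_j`: the unit-task instance
`I` (jobs `j < n`, integer delays `L j`, prescribed first-task order `π`) has a feasible
schedule respecting `π` with makespan at most `C` iff the extended instance `I'` with `M`
helper jobs (helper `j`, for `n ≤ j < n + M`, has delay `C + 2(j - n)`), whose prescribed
first-task sequence schedules the helpers in decreasing index order followed by the original
jobs in order `π`, has a feasible schedule respecting this sequence with total completion time
at most `z = n(M + C) + M² + M(M+1)/2 + MC`. -/
theorem unit_tasks_fixed_sequence_reduction (n : ℕ) (L : ℕ → ℤ)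
    (hL : ∀ j, j < n → 0 ≤ L j) (π : Equiv.Perm (Fin n)) (C M : ℕ)
    (hC : 0 < C) (hM : n * C < M) :
    ((∃ S : ℕ → ℝ, Feasible n (fun _ => 1) (fun j => (L j : ℝ)) (fun _ => 1) S ∧
        StrictMono (fun k : Fin n => S (π k)) ∧
        ∀ j, j < n → cTime (fun _ => 1) (fun j => (L j : ℝ)) (fun _ => 1) S j ≤ (C : ℝ)) ↔
      (∃ S' : ℕ → ℝ,
        Feasible (n + M) (fun _ => 1)
          (fun j => if j < n then (L j : ℝ) else (C : ℝ) + 2 * ((j - n : ℕ) : ℝ))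
          (fun _ => 1) S' ∧
        (∀ i, n ≤ i → ∀ j, i < j → j < n + M → S' j < S' i) ∧
        (∀ j, n ≤ j → j < n + M → ∀ i, i < n → S' j < S' i) ∧
        StrictMono (fun k : Fin n => S' (π k)) ∧
        totalC (n + M) (fun _ => 1)
          (fun j => if j < n then (L j : ℝ) else (C : ℝ) + 2 * ((j - n : ℕ) : ℝ))
          (fun _ => 1) S'
          ≤ (n : ℝ) * ((M : ℝ) + C) + (M : ℝ) ^ 2 + (M : ℝ) * ((M : ℝ) + 1) / 2
            + (M : ℝ) * C)) := by
  have hLR : ∀ j, j < n → (0 : ℝ) ≤ (L j : ℝ) := fun j hj => by exact_mod_cast hL j hj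
  have hMpos : 0 < M := by omega
  constructor
  · rintro ⟨S, hF, hmono, hc⟩
    have h1 : ∀ j, j < n →
        (fun j => if j < n then S j + M else (M : ℝ) - 1 - ((j - n : ℕ) : ℝ)) j = S j + M := by
      intro j hj; simp [hj]
    have h2 : ∀ k, (fun j => if j < n then S j + M else (M : ℝ) - 1 - ((j - n : ℕ) : ℝ)) (n + k)
        = (M : ℝ) - 1 - k := by
      intro k; simp
    generalize (fun j => if j < n then S j + M else (M : ℝ) - 1 - ((j - n : ℕ) : ℝ)) = S' at h1 h2
    refine ⟨S', reduction_forward n _ hLR C M S hF hc S' h1 h2, ?_, ?_, ?_, ?_⟩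
    · intro i hi j hij hj
      obtain ⟨k, rfl⟩ := Nat.exists_eq_add_of_le hi
      obtain ⟨l, rfl⟩ := Nat.exists_eq_add_of_le (hi.trans hij.le)
      rw [h2, h2]
      have : (k : ℝ) < l := by exact_mod_cast (by omega : k < l)
      linarith
    · intro j hj hj' i hi
      obtain ⟨k, rfl⟩ := Nat.exists_eq_add_of_le hj
      rw [h2, h1 i hi]
      have := hF.1 i hi
      have : (0 : ℝ) ≤ k := Nat.cast_nonneg k
      linarith
    · intro k l hkl
      have := hmono hkl
      simp only at this ⊢
      rw [h1 _ (π k).2, h1 _ (π l).2]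
      linarith
    · rw [totalC, Finset.sum_range_add]
      have e1 : ∑ j ∈ Finset.range n, cTime (fun _ => 1)
          (fun j => if j < n then (L j : ℝ) else (C : ℝ) + 2 * ((j - n : ℕ) : ℝ))
          (fun _ => 1) S' j ≤ ∑ j ∈ Finset.range n, ((M : ℝ) + C) := by
        refine Finset.sum_le_sum fun j hj => ?_
        have hj := Finset.mem_range.1 hj
        have := hc j hj
        simp only [cTime, hj, if_true, h1 j hj] at this ⊢
        linarith
      have e2 : ∑ k ∈ Finset.range M, cTime (fun _ => 1)
          (fun j => if j < n then (L j : ℝ) else (C : ℝ) + 2 * ((j - n : ℕ) : ℝ))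
          (fun _ => 1) S' (n + k) = ∑ k ∈ Finset.range M, ((M : ℝ) + C + k + 1) := by
        refine Finset.sum_congr rfl fun k _ => ?_
        simp [cTime, h2]
        ring
      rw [e2, sum_helper]
      simp at e1
      linarith
  · rintro ⟨S', hF, ho1, ho2, hmono, hz⟩
    rw [feasible_unit_iff] at hF
    obtain ⟨f0, f1, f2, f3⟩ := hF
    have main := reduction_backward n (fun j => (L j : ℝ)) hLR C M hM S' (fun k => S' (n + k))
      (fun k hk => f0 _ (by omega))
      (fun k hk => by
        have a := ho1 (n + k) (by omega) (n + (k + 1)) (by omega) (by omega)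
        rcases f1 (n + k) (by omega) (n + (k + 1)) (by omega) (by omega) with b | b
        · linarith
        · exact b)
      (fun i hi => by
        have a := ho2 (n + 0) (by omega) (by omega) i hi
        rcases f1 (n + 0) (by omega) i (by omega) (by omega) with b | b
        · exact b
        · linarith)
      (fun k hk l hl hkl => by
        have a := f2 (n + k) (by omega) (n + l) (by omega) (by omega)
        simp at a
        rcases a with a | a
        · left; linarith
        · right; linarith)
      (fun i hi k hk => by
        have a := f2 i (by omega) (n + k) (by omega) (by omega)
        simp [hi] at a
        rcases a with a | a
        · left; linarith
        · right; linarith)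
      (by
        rw [sum_helper]
        rw [totalC, Finset.sum_range_add] at hz
        have e1 : ∑ j ∈ Finset.range n, cTime (fun _ => 1)
            (fun j => if j < n then (L j : ℝ) else (C : ℝ) + 2 * ((j - n : ℕ) : ℝ))
            (fun _ => 1) S' j = ∑ j ∈ Finset.range n, (S' j + 1 + (L j : ℝ) + 1) := by
          refine Finset.sum_congr rfl fun j hj => ?_
          have hj := Finset.mem_range.1 hj
          simp [cTime, hj]
        have e2 : ∑ k ∈ Finset.range M, cTime (fun _ => 1)
            (fun j => if j < n then (L j : ℝ) else (C : ℝ) + 2 * ((j - n : ℕ) : ℝ))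
            (fun _ => 1) S' (n + k)
            = ∑ k ∈ Finset.range M, (S' (n + k) + 1 + ((C : ℝ) + 2 * k) + 1) := by
          refine Finset.sum_congr rfl fun k _ => ?_
          simp [cTime]
        rw [e1, e2] at hz
        linarith)
    refine ⟨fun j => S' j - (S' (n + 0) + 1), ?_, ?_, ?_⟩
    · rw [feasible_unit_iff]
      refine ⟨?_, ?_, ?_, ?_⟩
      · intro i hi
        have a := ho2 (n + 0) (by omega) (by omega) i hi
        rcases f1 (n + 0) (by omega) i (by omega) (by omega) with b | b
        · linarith
        · linarith
      · intro i hi j hj hij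
        rcases f1 i (by omega) j (by omega) hij with a | a
        · left; linarith
        · right; linarith
      · intro i hi j hj hij
        have a := f2 i (by omega) j (by omega) hij
        simp only [hi, hj, if_true] at a
        rcases a with a | a
        · left; linarith
        · right; linarith
      · intro i hi j hj
        have a := f3 i (by omega) j (by omega)
        simp only [hj, if_true] at a
        rcases a with a | a
        · left; linarith
        · right; linarith
    · intro k l hkl
      have := hmono hkl
      simp only at this ⊢
      linarith
    · intro j hj
      have := main j hj
      simp only [cTime] at this ⊢
      linarith
end

section
/- Let a coupled-task instance on n jobs be given, and let σ₁ and σ₂ be any two feasible schedules for it. Then for every δ > 0 there exists a feasible schedule σ for the same instance whose makespan satisfies max_j C_j(σ) ≤ (1 + δ) · max_j C_j(σ₁) and whose total completion time satisfies ∑_{j=1}^{n} C_j(σ) ≤ ((δ + 1)/δ) · ∑_{j=1}^{n} C_j(σ₂). -/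
open Finset

/-- Stein–Wein composition for coupled-task scheduling: for any two feasible schedules `S₁`,
`S₂` of the same instance and any `δ > 0`, there is a feasible schedule whose makespan is at
most `(1 + δ)` times the makespan of `S₁` and whose total completion time is at most
`(δ + 1)/δ` times the total completion time of `S₂`. -/
theorem stein_wein_composition (n : ℕ) (hn : 0 < n) (a L b : ℕ → ℝ)
    (ha : ∀ j, j < n → 0 < a j) (hL : ∀ j, j < n → 0 ≤ L j) (hb : ∀ j, j < n → 0 < b j)
    (S₁ S₂ : ℕ → ℝ) (h₁ : Feasible n a L b S₁) (h₂ : Feasible n a L b S₂)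
    (δ : ℝ) (hδ : 0 < δ) :
    ∃ S : ℕ → ℝ, Feasible n a L b S ∧
      (∀ j, j < n → cTime a L b S j ≤
        (1 + δ) * (Finset.range n).sup' (Finset.nonempty_range_iff.mpr hn.ne')
          (cTime a L b S₁)) ∧
      totalC n a L b S ≤ ((δ + 1) / δ) * totalC n a L b S₂ := by
  classical
  set M := (Finset.range n).sup' (Finset.nonempty_range_iff.mpr hn.ne')
          (cTime a L b S₁) with hM
  have hle : ∀ j, j < n → cTime a L b S₁ j ≤ M := fun j hj =>
    Finset.le_sup' (cTime a L b S₁) (Finset.mem_range.mpr hj)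
  clear_value M
  obtain ⟨p1, q1, r1, s1⟩ := h₁
  obtain ⟨p2, q2, r2, s2⟩ := h₂
  simp only [task1, task2, Set.disjoint_left, Set.mem_Ico, cTime] at q1 r1 s1 q2 r2 s2 hle
  have hMpos : 0 < M := by
    have := hle 0 hn; have := p1 0 hn; have := ha 0 hn; have := hL 0 hn; have := hb 0 hn
    linarith
  have hT : 0 < δ * M := mul_pos hδ hMpos
  let S : ℕ → ℝ := fun j => if S₂ j + a j + L j + b j ≤ δ * M then S₂ j else δ * M + S₁ j
  have hS : ∀ j, (S₂ j + a j + L j + b j ≤ δ * M ∧ S j = S₂ j) ∨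
      (δ * M < S₂ j + a j + L j + b j ∧ S j = δ * M + S₁ j) := by
    intro j
    by_cases h : S₂ j + a j + L j + b j ≤ δ * M
    · left; exact ⟨h, if_pos h⟩
    · right; exact ⟨not_le.mp h, if_neg h⟩
  clear_value S
  refine ⟨S, ⟨?_, ?_, ?_, ?_⟩, ?_, ?_⟩
  · intro j hj
    have := p1 j hj
    have := p2 j hj
    rcases hS j with ⟨_, h⟩ | ⟨_, h⟩ <;> rw [h] <;> linarith
  all_goals try simp only [task1, task2, Set.disjoint_left, Set.mem_Ico]
  · rintro i hi j hj hij x ⟨hx1, hx2⟩ ⟨hx3, hx4⟩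
    have := p1 i hi; have := p1 j hj
    have := hL i hi; have := hb i hi; have := hL j hj; have := hb j hj
    rcases hS i with ⟨_, h⟩ | ⟨_, h⟩ <;> rcases hS j with ⟨_, h'⟩ | ⟨_, h'⟩ <;>
      rw [h] at hx1 hx2 <;> rw [h'] at hx3 hx4
    · exact q2 i hi j hj hij ⟨hx1, hx2⟩ ⟨hx3, hx4⟩
    · linarith
    · linarith
    · exact q1 i hi j hj hij (a := x - δ * M) ⟨by linarith, by linarith⟩
        ⟨by linarith, by linarith⟩
  · rintro i hi j hj hij x ⟨hx1, hx2⟩ ⟨hx3, hx4⟩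
    have := p1 i hi; have := p1 j hj; have := ha i hi; have := ha j hj
    have := hL i hi; have := hb i hi; have := hL j hj; have := hb j hj
    rcases hS i with ⟨_, h⟩ | ⟨_, h⟩ <;> rcases hS j with ⟨_, h'⟩ | ⟨_, h'⟩ <;>
      rw [h] at hx1 hx2 <;> rw [h'] at hx3 hx4
    · exact r2 i hi j hj hij ⟨hx1, hx2⟩ ⟨hx3, hx4⟩
    · linarith
    · linarith
    · exact r1 i hi j hj hij (a := x - δ * M) ⟨by linarith, by linarith⟩
        ⟨by linarith, by linarith⟩
  · rintro i hi j hj x ⟨hx1, hx2⟩ ⟨hx3, hx4⟩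
    have := p1 i hi; have := p1 j hj; have := ha i hi; have := ha j hj
    have := hL i hi; have := hb i hi; have := hL j hj; have := hb j hj
    rcases hS i with ⟨_, h⟩ | ⟨_, h⟩ <;> rcases hS j with ⟨_, h'⟩ | ⟨_, h'⟩ <;>
      rw [h] at hx1 hx2 <;> rw [h'] at hx3 hx4
    · exact s2 i hi j hj ⟨hx1, hx2⟩ ⟨hx3, hx4⟩
    · linarith
    · linarith
    · exact s1 i hi j hj (a := x - δ * M) ⟨by linarith, by linarith⟩
        ⟨by linarith, by linarith⟩
  · intro j hj
    have := hle j hj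
    rcases hS j with ⟨_, h⟩ | ⟨_, h⟩ <;> simp only [cTime, h] <;> linarith
  · unfold totalC
    rw [Finset.mul_sum]
    refine Finset.sum_le_sum fun j hj => ?_
    have hj := Finset.mem_range.mp hj
    have := hle j hj; have := p2 j hj; have := ha j hj; have := hL j hj; have := hb j hj
    rw [div_mul_eq_mul_div, le_div_iff₀ hδ]
    rcases hS j with ⟨_, h⟩ | ⟨_, h⟩ <;> simp only [cTime, h]
    · nlinarith
    · have h3 : δ * M + S₁ j + a j + L j + b j ≤ (δ + 1) * M := by linarith
      have h4 := mul_le_mul_of_nonneg_right h3 hδ.le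
      nlinarith
end

section
/- Consider an n-job coupled-task instance with unit tasks (a_j = b_j = 1 for all j) and arbitrary delay times L_j. Then for every pair of feasible schedules σ₁, σ₂ there exists a feasible schedule σ with makespan max_j C_j(σ) ≤ 3.25 · max_j C_j(σ₁) and total completion time ∑_{j=1}^{n} C_j(σ) ≤ 3.25 · ∑_{j=1}^{n} C_j(σ₂); in particular some feasible schedule is simultaneously a 3.25-approximation for the minimum makespan and a 3.25-approximation for the minimum total completion time. -/
open Finset

/-- Two unit half-open intervals are disjoint iff one lies entirely before the other. -/
theorem disj_unit (x y : ℝ) :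
    Disjoint (Set.Ico x (x + 1)) (Set.Ico y (y + 1)) ↔ x + 1 ≤ y ∨ y + 1 ≤ x := by
  rw [Set.Ico_disjoint_Ico, min_le_iff, le_max_iff, le_max_iff]
  constructor
  · rintro ((h | h) | (h | h))
    · linarith
    · exact Or.inl h
    · exact Or.inr h
    · linarith
  · rintro (h | h)
    · exact Or.inl (Or.inr h)
    · exact Or.inr (Or.inl h)

/-- Bi-objective `(3.25, 3.25)`-approximation for `1|(1, L_j, 1)|(C_max, ∑ C_j)`: for any two
feasible schedules `S₁`, `S₂` there is a feasible schedule whose makespan is at most `3.25`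
times the makespan of `S₁` and whose total completion time is at most `3.25` times the total
completion time of `S₂`. -/
theorem biobjective_unit_tasks (n : ℕ) (hn : 0 < n) (L : ℕ → ℝ)
    (hL : ∀ j, j < n → 0 ≤ L j) (S₁ S₂ : ℕ → ℝ)
    (h₁ : Feasible n (fun _ => 1) L (fun _ => 1) S₁)
    (h₂ : Feasible n (fun _ => 1) L (fun _ => 1) S₂) :
    ∃ S : ℕ → ℝ, Feasible n (fun _ => 1) L (fun _ => 1) S ∧
      (∀ j, j < n → cTime (fun _ => 1) L (fun _ => 1) S j ≤
        3.25 * (Finset.range n).sup' (Finset.nonempty_range_iff.mpr hn.ne')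
          (cTime (fun _ => 1) L (fun _ => 1) S₁)) ∧
      totalC n (fun _ => 1) L (fun _ => 1) S ≤
        3.25 * totalC n (fun _ => 1) L (fun _ => 1) S₂ := by
  classical
  set T := (Finset.range n).sup' (Finset.nonempty_range_iff.mpr hn.ne')
          (cTime (fun _ => 1) L (fun _ => 1) S₁) with hT
  have hle : ∀ j, j < n → S₁ j + 1 + L j + 1 ≤ T := fun j hj =>
    Finset.le_sup' (cTime (fun _ => 1) L (fun _ => 1) S₁) (Finset.mem_range.mpr hj)
  clear_value T
  obtain ⟨p1, q1, r1, s1⟩ := h₁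
  obtain ⟨p2, q2, r2, s2⟩ := h₂
  simp only [task1, task2, disj_unit] at q1 r1 s1 q2 r2 s2
  have hT0 : 0 ≤ T := by linarith [hle 0 hn, p1 0 hn, hL 0 hn]
  -- jobs finished by `T` in `S₂` stay there; the others follow `S₁` shifted by `T`
  refine ⟨fun j => if S₂ j + 1 + L j + 1 ≤ T then S₂ j else T + S₁ j, ⟨?_, ?_, ?_, ?_⟩, ?_, ?_⟩
  · intro j hj
    have := p1 j hj
    have := p2 j hj
    dsimp only
    split_ifs <;> linarith
  · intro i hi j hj hij
    simp only [task1, disj_unit]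
    have := p1 i hi
    have := p1 j hj
    have := hL i hi
    have := hL j hj
    split_ifs with h h' h'
    · exact q2 i hi j hj hij
    · left; linarith
    · right; linarith
    · exact (q1 i hi j hj hij).imp (fun h => by linarith) (fun h => by linarith)
  · intro i hi j hj hij
    simp only [task2, disj_unit]
    have := p1 i hi
    have := p1 j hj
    have := hL i hi
    have := hL j hj
    split_ifs with h h' h'
    · exact r2 i hi j hj hij
    · left; linarith
    · right; linarith
    · exact (r1 i hi j hj hij).imp (fun h => by linarith) (fun h => by linarith)
  · intro i hi j hj
    simp only [task1, task2, disj_unit]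
    have := p1 i hi
    have := p1 j hj
    have := hL i hi
    have := hL j hj
    split_ifs with h h' h'
    · exact s2 i hi j hj
    · left; linarith
    · right; linarith
    · exact (s1 i hi j hj).imp (fun h => by linarith) (fun h => by linarith)
  · intro j hj
    have := hle j hj
    simp only [cTime]
    split_ifs with h <;> linarith
  · unfold totalC
    rw [Finset.mul_sum]
    refine Finset.sum_le_sum fun j hj => ?_
    have hj := Finset.mem_range.mp hj
    have := hle j hj
    have := p2 j hj
    have := hL j hj
    simp only [cTime]
    split_ifs with h <;> linarith
end

section
/- Consider an n-job coupled-task instance in which all jobs have the same delay time L (L_j = L for all j) and arbitrary task processing times a_j, b_j. Then for every pair of feasible schedules σ₁, σ₂ there exists a feasible schedule σ with makespan max_j C_j(σ) ≤ 6 · max_j C_j(σ₁) and total completion time ∑_{j=1}^{n} C_j(σ) ≤ 6 · ∑_{j=1}^{n} C_j(σ₂); in particular some feasible schedule is simultaneously a 6-approximation for the minimum makespan and a 6-approximation for the minimum total completion time. -/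
open Finset

lemma ico_disj {p q r s : ℝ} (h1 : p < q) (h2 : r < s) :
    Disjoint (Set.Ico p q) (Set.Ico r s) ↔ q ≤ r ∨ s ≤ p := by
  rw [Set.Ico_disjoint_Ico, min_le_iff, le_max_iff, le_max_iff]
  constructor
  · rintro ((h | h) | (h | h))
    · linarith
    · exact Or.inl h
    · exact Or.inr h
    · linarith
  · rintro (h | h)
    · exact Or.inl (Or.inr h)
    · exact Or.inr (Or.inl h)

/-- Bi-objective `(6,6)`-approximation for `1|(a_j, L, b_j)|(C_max, ∑ C_j)`: for any two
feasible schedules `S₁`, `S₂` there is a feasible schedule whose makespan is at most `6` times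
the makespan of `S₁` and whose total completion time is at most `6` times the total completion
time of `S₂`. -/
theorem biobjective_six_six_common_delay (n : ℕ) (hn : 0 < n) (a b : ℕ → ℝ) (L : ℝ)
    (ha : ∀ j, j < n → 0 < a j) (hb : ∀ j, j < n → 0 < b j) (hL : 0 ≤ L)
    (S₁ S₂ : ℕ → ℝ)
    (h₁ : Feasible n a (fun _ => L) b S₁) (h₂ : Feasible n a (fun _ => L) b S₂) :
    ∃ S : ℕ → ℝ, Feasible n a (fun _ => L) b S ∧
      (∀ j, j < n → cTime a (fun _ => L) b S j ≤
        6 * (Finset.range n).sup' (Finset.nonempty_range_iff.mpr hn.ne')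
          (cTime a (fun _ => L) b S₁)) ∧
      totalC n a (fun _ => L) b S ≤ 6 * totalC n a (fun _ => L) b S₂ := by
  set M := (Finset.range n).sup' (Finset.nonempty_range_iff.mpr hn.ne')
          (cTime a (fun _ => L) b S₁) with hM
  have hle : ∀ j, j < n → S₁ j + a j + L + b j ≤ M := fun j hj =>
    Finset.le_sup' (cTime a (fun _ => L) b S₁) (Finset.mem_range.mpr hj)
  clear_value M
  obtain ⟨p1, q1, r1, t1⟩ := h₁
  obtain ⟨p2, q2, r2, t2⟩ := h₂
  have hM0 : 0 ≤ M := by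
    have := hle 0 hn
    have := p1 0 hn
    have := ha 0 hn
    have := hb 0 hn
    linarith
  refine ⟨fun j => if S₂ j + a j + L + b j ≤ M then S₂ j else M + S₁ j,
    ⟨?_, ?_, ?_, ?_⟩, ?_, ?_⟩
  · intro j hj
    have := p1 j hj
    have := p2 j hj
    dsimp only
    split_ifs <;> linarith
  · intro i hi j hj hij
    have e1 := q1 i hi j hj hij
    have e2 := q2 i hi j hj hij
    have := p1 i hi
    have := p1 j hj
    have := ha i hi
    have := ha j hj
    have := hb i hi
    have := hb j hj
    simp only [task1] at e1 e2 ⊢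
    rw [ico_disj (by linarith) (by linarith)] at e1 e2 ⊢
    split_ifs <;> grind
  · intro i hi j hj hij
    have e1 := r1 i hi j hj hij
    have e2 := r2 i hi j hj hij
    have := p1 i hi
    have := p1 j hj
    have := ha i hi
    have := ha j hj
    have := hb i hi
    have := hb j hj
    simp only [task2] at e1 e2 ⊢
    rw [ico_disj (by linarith) (by linarith)] at e1 e2 ⊢
    split_ifs <;> grind
  · intro i hi j hj
    have e1 := t1 i hi j hj
    have e2 := t2 i hi j hj
    have := p1 i hi
    have := p1 j hj
    have := ha i hi
    have := ha j hj
    have := hb i hi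
    have := hb j hj
    simp only [task1, task2] at e1 e2 ⊢
    rw [ico_disj (by linarith) (by linarith)] at e1 e2 ⊢
    split_ifs <;> grind
  · intro j hj
    have := hle j hj
    simp only [cTime]
    split_ifs <;> linarith
  · unfold totalC
    rw [Finset.mul_sum]
    refine Finset.sum_le_sum fun j hj => ?_
    have hj := Finset.mem_range.mp hj
    have := hle j hj
    have := p2 j hj
    have := ha j hj
    have := hb j hj
    simp only [cTime]
    split_ifs <;> linarith
end

section
/- Consider an n-job coupled-task instance in which for every job j the first-task processing time, the delay time, and the second-task processing time are all equal to a job-dependent value p_j (a_j = L_j = b_j = p_j for all j). Then for every pair of feasible schedules σ₁, σ₂ there exists a feasible schedule σ with makespan max_j C_j(σ) ≤ 4 · max_j C_j(σ₁) and total completion time ∑_{j=1}^{n} C_j(σ) ≤ 4 · ∑_{j=1}^{n} C_j(σ₂); in particular some feasible schedule is simultaneously a 4-approximation for the minimum makespan and a 4-approximation for the minimum total completion time. -/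
open Finset

/-- Disjoint first tasks: if `S i < S j` then the first task of `i` ends before `S j`. -/
lemma task1_sep {p S : ℕ → ℝ} {i j : ℕ} (hj : 0 < p j)
    (h : Disjoint (task1 p S i) (task1 p S j)) (hij : S i ≤ S j) : S i + p i ≤ S j := by
  by_contra hc
  push Not at hc
  exact Set.disjoint_left.mp h (show S j ∈ Set.Ico (S i) (S i + p i) from ⟨hij, hc⟩)
    (show S j ∈ Set.Ico (S j) (S j + p j) from ⟨le_refl _, by linarith⟩)

/-- Load bound: disjoint first tasks contained in `[0, T)` have total length at most `T`. -/
lemma load_le {n : ℕ} {p S : ℕ → ℝ} (hp : ∀ j, j < n → 0 < p j)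
    (h : Feasible n p p p S) (A : Finset ℕ) : (∀ i ∈ A, i < n) →
    ∀ T : ℝ, 0 ≤ T → (∀ i ∈ A, S i + p i ≤ T) → ∑ i ∈ A, p i ≤ T := by
  induction A using Finset.induction_on_max_value S with
  | empty => intro _ T hT _; simpa using hT
  | insert a s ha hmax ih =>
    intro hA T hT hb
    rw [Finset.sum_insert ha]
    have han := hA a (Finset.mem_insert_self _ _)
    have h1 := ih (fun i hi => hA i (Finset.mem_insert_of_mem hi)) (S a) (h.1 a han)
      (fun i hi => task1_sep (hp a han)
        (h.2.1 i (hA i (Finset.mem_insert_of_mem hi)) a han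
          (fun e => ha (e ▸ hi))) (hmax i hi))
    have h2 := hb a (Finset.mem_insert_self _ _)
    linarith

/-- Bi-objective `(4,4)`-approximation for `1|(p_j, p_j, p_j)|(C_max, ∑ C_j)`: for any two
feasible schedules `S₁`, `S₂` there is a feasible schedule whose makespan is at most `4` times
the makespan of `S₁` and whose total completion time is at most `4` times the total completion
time of `S₂`. -/
theorem biobjective_four_four_pj_pj_pj (n : ℕ) (hn : 0 < n) (p : ℕ → ℝ)
    (hp : ∀ j, j < n → 0 < p j) (S₁ S₂ : ℕ → ℝ)
    (h₁ : Feasible n p p p S₁) (h₂ : Feasible n p p p S₂) :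
    ∃ S : ℕ → ℝ, Feasible n p p p S ∧
      (∀ j, j < n → cTime p p p S j ≤
        4 * (Finset.range n).sup' (Finset.nonempty_range_iff.mpr hn.ne') (cTime p p p S₁)) ∧
      totalC n p p p S ≤ 4 * totalC n p p p S₂ := by
  classical
  set B : ℕ → Finset ℕ := fun j => (Finset.range n).filter (fun i => S₂ i < S₂ j) with hB
  set S : ℕ → ℝ := fun j => 3 * ∑ i ∈ B j, p i with hS
  have hBn : ∀ j, ∀ i ∈ B j, i < n := fun j i hi =>
    Finset.mem_range.mp (Finset.mem_filter.mp hi).1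
  have hBself : ∀ j, j ∉ B j := fun j hj => lt_irrefl _ (Finset.mem_filter.mp hj).2
  have hS0 : ∀ j, 0 ≤ S j := fun j =>
    mul_nonneg (by norm_num) (Finset.sum_nonneg fun i hi => (hp i (hBn j i hi)).le)
  have hins : ∀ j, S j + 3 * p j = 3 * ∑ i ∈ insert j (B j), p i := by
    intro j
    rw [Finset.sum_insert (hBself j)]
    simp only [hS]
    ring
  have hinsn : ∀ j, j < n → ∀ i ∈ insert j (B j), i < n := by
    intro j hj i hi
    rcases Finset.mem_insert.mp hi with rfl | hi
    · exact hj
    · exact hBn j i hi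
  have hlt : ∀ i, i < n → ∀ j, j < n → S₂ i < S₂ j → S i + 3 * p i ≤ S j := by
    intro i hi j hj hij
    rw [hins]
    refine mul_le_mul_of_nonneg_left ?_ (by norm_num)
    refine Finset.sum_le_sum_of_subset_of_nonneg ?_ (fun k hk _ => (hp k (hBn j k hk)).le)
    intro k hk
    rcases Finset.mem_insert.mp hk with rfl | hk
    · exact Finset.mem_filter.mpr ⟨Finset.mem_range.mpr hi, hij⟩
    · have := Finset.mem_filter.mp hk
      exact Finset.mem_filter.mpr ⟨this.1, this.2.trans hij⟩
  have hsep : ∀ i, i < n → ∀ j, j < n → i ≠ j →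
      S i + 3 * p i ≤ S j ∨ S j + 3 * p j ≤ S i := by
    intro i hi j hj hij
    rcases lt_trichotomy (S₂ i) (S₂ j) with h | h | h
    · exact Or.inl (hlt i hi j hj h)
    · have := task1_sep (hp j hj) (h₂.2.1 i hi j hj hij) h.le
      have := hp i hi
      linarith
    · exact Or.inr (hlt j hj i hi h)
  have hc : ∀ j, cTime p p p S j = 3 * ∑ i ∈ insert j (B j), p i := by
    intro j
    rw [← hins]
    simp only [cTime]
    ring
  refine ⟨S, ⟨fun j _ => hS0 j, ?_, ?_, ?_⟩, ?_, ?_⟩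
  · intro i hi j hj hij
    refine Set.disjoint_left.mpr ?_
    rintro x ⟨h1, h2⟩ ⟨h3, h4⟩
    have := hp i hi
    have := hp j hj
    rcases hsep i hi j hj hij with h | h <;> linarith
  · intro i hi j hj hij
    refine Set.disjoint_left.mpr ?_
    rintro x ⟨h1, h2⟩ ⟨h3, h4⟩
    have := hp i hi
    have := hp j hj
    rcases hsep i hi j hj hij with h | h <;> linarith
  · intro i hi j hj
    refine Set.disjoint_left.mpr ?_
    rintro x ⟨h1, h2⟩ ⟨h3, h4⟩
    have := hp i hi
    have := hp j hj
    by_cases hij : i = j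
    · subst hij
      linarith
    · rcases hsep i hi j hj hij with h | h <;> linarith
  · intro j hj
    rw [hc]
    have hM : ∀ i, i < n → cTime p p p S₁ i ≤ (Finset.range n).sup'
        (Finset.nonempty_range_iff.mpr hn.ne') (cTime p p p S₁) := fun i hi =>
      Finset.le_sup' (cTime p p p S₁) (Finset.mem_range.mpr hi)
    generalize (Finset.range n).sup'
        (Finset.nonempty_range_iff.mpr hn.ne') (cTime p p p S₁) = M at hM ⊢
    simp only [cTime] at hM
    have hM0 : 0 ≤ M := by
      have := hM j hj
      have := hp j hj
      have := h₁.1 j hj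
      linarith
    have := load_le hp h₁ (insert j (B j)) (hinsn j hj) M hM0 (by
      intro i hi
      have := hM i (hinsn j hj i hi)
      have := hp i (hinsn j hj i hi)
      linarith)
    linarith
  · unfold totalC
    rw [Finset.mul_sum]
    refine Finset.sum_le_sum fun j hj => ?_
    have hj := Finset.mem_range.mp hj
    have hpj := hp j hj
    have h0 := h₂.1 j hj
    rw [hc]
    have := load_le hp h₂ (insert j (B j)) (hinsn j hj) (S₂ j + p j) (by linarith) (by
      intro i hi
      rcases Finset.mem_insert.mp hi with rfl | hi
      · exact le_refl _
      · have hin := hBn j i hi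
        have hlt' := (Finset.mem_filter.mp hi).2
        have := task1_sep hpj (h₂.2.1 i hin j hj (fun e => hBself j (e ▸ hi))) hlt'.le
        linarith)
    simp only [cTime]
    linarith
end
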